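/- arXiv:2012.09551 — 8 statements merged into one kernel-verified Lean document; each statement's English description precedes it below -/
import Mathlib

section
/- Let G be a finite almost simple group with socle L, and let G = HK be a factorization. Set G* = HL ∩ KL, H* = H ∩ G*, and K* = K ∩ G*. Then L is a normal subgroup of G* ≤ G, G* = H*K* is a factorization, H* ≤ H, K* ≤ K, H* ∩ L = H ∩ L, K* ∩ L = K ∩ L, and H*L = K*L = G*. -/
open Pointwise

/-- Let `G` be a finite almost simple group with socle `L` and let
`G = HK` be a factorization. Setting `G* = HL ∩ KL`, `H* = H ∩ G*`, `K* = K ∩ G*`,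
we have: `L ⊴ G* ≤ G`, `G* = H*K*`, `H* ≤ H`, `K* ≤ K`, `H* ∩ L = H ∩ L`,
`K* ∩ L = K ∩ L`, and `H*L = K*L = G*`. -/
theorem stmt_1 {G : Type*} [Group G] [Finite G] (L H K : Subgroup G) [L.Normal]
    (hsimple : IsSimpleGroup L) (hnonab : ∃ a b : L, a * b ≠ b * a)
    (hcent : Subgroup.centralizer (L : Set G) = ⊥)
    (hfact : (H : Set G) * (K : Set G) = Set.univ)
    (Gstar : Subgroup G)
    (hGstar : (Gstar : Set G) =
      ((H : Set G) * (L : Set G)) ∩ ((K : Set G) * (L : Set G))) :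
    L ≤ Gstar ∧ (L.subgroupOf Gstar).Normal ∧
      ((H ⊓ Gstar : Subgroup G) : Set G) * ((K ⊓ Gstar : Subgroup G) : Set G) =
        (Gstar : Set G) ∧
      H ⊓ Gstar ≤ H ∧ K ⊓ Gstar ≤ K ∧
      (H ⊓ Gstar) ⊓ L = H ⊓ L ∧ (K ⊓ Gstar) ⊓ L = K ⊓ L ∧
      ((H ⊓ Gstar : Subgroup G) : Set G) * (L : Set G) = (Gstar : Set G) ∧
      ((K ⊓ Gstar : Subgroup G) : Set G) * (L : Set G) = (Gstar : Set G) := by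
  have hmem : ∀ g : G, g ∈ Gstar ↔
      (∃ h ∈ H, ∃ l ∈ L, h * l = g) ∧ (∃ k ∈ K, ∃ l ∈ L, k * l = g) := by
    intro g
    rw [← SetLike.mem_coe, hGstar]
    simp only [Set.mem_inter_iff, Set.mem_mul, SetLike.mem_coe]
  have hL : L ≤ Gstar := fun l hl =>
    (hmem l).2 ⟨⟨1, H.one_mem, l, hl, one_mul l⟩, ⟨1, K.one_mem, l, hl, one_mul l⟩⟩
  refine ⟨hL, inferInstance, ?_, inf_le_left, inf_le_left, ?_, ?_, ?_, ?_⟩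
  · ext g
    constructor
    · rintro ⟨h, hh, k, hk, rfl⟩
      exact Gstar.mul_mem hh.2 hk.2
    · intro hg
      have hu : g ∈ (H : Set G) * (K : Set G) := by rw [hfact]; trivial
      obtain ⟨h, hh, k, hk, hgk⟩ := hu
      have hgk : h * k = g := hgk
      obtain ⟨⟨h', hh', l, hl, hgl⟩, -⟩ := (hmem g).1 hg
      have hkG : k ∈ Gstar := by
        refine (hmem k).2 ⟨⟨h⁻¹ * h', H.mul_mem (H.inv_mem hh) hh', l, hl, ?_⟩,
          ⟨k, hk, 1, L.one_mem, mul_one k⟩⟩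
        rw [mul_assoc, hgl, ← hgk, inv_mul_cancel_left]
      have hhG : h ∈ Gstar := by
        rw [← hgk] at hg
        exact (Gstar.mul_mem_cancel_right hkG).1 hg
      exact ⟨h, ⟨hh, hhG⟩, k, ⟨hk, hkG⟩, hgk⟩
  · rw [inf_assoc, inf_eq_right.2 hL]
  · rw [inf_assoc, inf_eq_right.2 hL]
  · ext g
    constructor
    · rintro ⟨h, hh, l, hl, rfl⟩
      exact Gstar.mul_mem hh.2 (hL hl)
    · intro hg
      obtain ⟨⟨h, hh, l, hl, rfl⟩, -⟩ := (hmem g).1 hg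
      exact ⟨h, ⟨hh, (Gstar.mul_mem_cancel_right (hL hl)).1 hg⟩, l, hl, rfl⟩
  · ext g
    constructor
    · rintro ⟨h, hh, l, hl, rfl⟩
      exact Gstar.mul_mem hh.2 (hL hl)
    · intro hg
      obtain ⟨-, ⟨h, hh, l, hl, rfl⟩⟩ := (hmem g).1 hg
      exact ⟨h, ⟨hh, (Gstar.mul_mem_cancel_right (hL hl)).1 hg⟩, l, hl, rfl⟩
end

section
/- Let n ≥ 2 be an integer and let F be a finite field with q elements. Then q^{n²−2} < |PSL_n(q)| < q^{n²−1}, where PSL_n(q) denotes the quotient of the special linear group SL_n(F) by its center. -/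
open Finset in
lemma aux_rec (x : ℝ) (n : ℕ) :
    ∏ i ∈ range (n + 1), (x ^ (n + 1) - x ^ i)
      = (x * x ^ n - 1) * x ^ n * ∏ i ∈ range n, (x ^ n - x ^ i) := by
  rw [prod_range_succ']
  have : ∀ i ∈ range n, x ^ (n + 1) - x ^ (i + 1) = x * (x ^ n - x ^ i) := by
    intro i _; ring
  rw [prod_congr rfl this, prod_mul_distrib, prod_const, card_range]
  ring

open Finset in
lemma aux_lower (x : ℝ) (hx : 2 ≤ x) (n : ℕ) (hn : 1 ≤ n) :
    x ^ (n ^ 2) * (x - 1) * (x * x ^ n - x ^ n + x)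
      ≤ (∏ i ∈ range n, (x ^ n - x ^ i)) * x ^ n * x ^ 2 := by
  induction n, hn using Nat.le_induction with
  | base =>
    simp
    nlinarith
  | succ n hn ih =>
    rw [aux_rec]
    have hA : 0 < x ^ (n ^ 2) := by positivity
    have hA' : x ^ ((n + 1) ^ 2) = x ^ (n ^ 2) * (x ^ n) ^ 2 * x := by ring
    have hy : x ≤ x ^ n := le_self_pow₀ (by linarith) (by omega)
    rw [hA', pow_succ x n]
    generalize x ^ n = y at *
    generalize x ^ (n ^ 2) = A at *
    generalize ∏ i ∈ range n, (y - x ^ i) = P at *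
    have h1 : 0 ≤ (x * y - 1) * y * x := by
      have : 0 ≤ x * y - 1 := by nlinarith
      have : 0 ≤ y := by linarith
      positivity
    have h2 := mul_le_mul_of_nonneg_left ih h1
    have h3 : 0 ≤ y * (x - 1) ^ 2 - x := by nlinarith [mul_nonneg (by linarith : (0:ℝ) ≤ y) (by nlinarith : 0 ≤ (x - 1) ^ 2 - 1)]
    have h4 : 0 ≤ A * (x - 1) * y * x * (y * (x - 1) ^ 2 - x) := by
      have : 0 ≤ x - 1 := by linarith
      have : 0 ≤ y := by linarith
      positivity
    linear_combination h2 + h4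

open Finset in
lemma aux_upper_step (x : ℝ) (hx : 2 ≤ x) (n : ℕ)
    (ih : (∏ i ∈ range n, (x ^ n - x ^ i)) * x ≤ x ^ (n ^ 2) * (x - 1)) (hn : 1 ≤ n) :
    (∏ i ∈ range (n + 1), (x ^ (n + 1) - x ^ i)) * x < x ^ ((n + 1) ^ 2) * (x - 1) := by
  rw [aux_rec]
  have hA : 0 < x ^ (n ^ 2) := by positivity
  have hA' : x ^ ((n + 1) ^ 2) = x ^ (n ^ 2) * (x ^ n) ^ 2 * x := by ring
  have hy : x ≤ x ^ n := le_self_pow₀ (by linarith) (by omega)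
  rw [hA']
  generalize x ^ n = y at *
  generalize x ^ (n ^ 2) = A at *
  generalize ∏ i ∈ range n, (y - x ^ i) = P at *
  have hy0 : 0 < y := by linarith
  have hx0 : 0 < x - 1 := by linarith
  have h1 : 0 ≤ (x * y - 1) * y := by
    have : 0 ≤ x * y - 1 := by nlinarith
    positivity
  have h2 := mul_le_mul_of_nonneg_left ih h1
  have h3 : 0 < A * (x - 1) * y := by positivity
  linear_combination h2 + h3

open Finset in
lemma aux_upper (x : ℝ) (hx : 2 ≤ x) (n : ℕ) (hn : 1 ≤ n) :
    (∏ i ∈ range n, (x ^ n - x ^ i)) * x ≤ x ^ (n ^ 2) * (x - 1) := by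
  induction n, hn using Nat.le_induction with
  | base => simp; linarith
  | succ n hn ih => exact (aux_upper_step x hx n ih hn).le

lemma aux_card_SL (n : ℕ) (hn : 2 ≤ n) (F : Type*) [Field F] [Fintype F] :
    Nat.card (Matrix.GeneralLinearGroup (Fin n) F) =
      Nat.card (Matrix.SpecialLinearGroup (Fin n) F) * Nat.card Fˣ := by
  haveI : Nonempty (Fin n) := ⟨⟨0, by omega⟩⟩
  let f : Matrix.GeneralLinearGroup (Fin n) F →* Fˣ := Matrix.GeneralLinearGroup.det
  have hf : Function.Surjective f := Matrix.GeneralLinearGroup.det_surjective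
  have h := f.ker.card_mul_index
  rw [Subgroup.index_ker, MonoidHom.range_eq_top.2 hf, Subgroup.card_top] at h
  rw [← h]
  congr 1
  symm
  refine Nat.card_congr (Equiv.ofBijective
    (fun A => ⟨Matrix.SpecialLinearGroup.toGL A, ?_⟩) ⟨?_, ?_⟩)
  · rw [MonoidHom.mem_ker]
    ext
    simp [f]
  · intro A B hAB
    exact Matrix.SpecialLinearGroup.toGL_injective (Subtype.ext_iff.1 hAB)
  · rintro ⟨B, hB⟩
    refine ⟨⟨B.1, ?_⟩, ?_⟩
    · have := congrArg Units.val (MonoidHom.mem_ker.1 hB)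
      simpa [f] using this
    · apply Subtype.ext
      ext
      rfl

/-- For `n ≥ 2` and a finite field `F` with `q` elements,
`q^{n²−2} < |PSL_n(q)| < q^{n²−1}`, where `PSL_n(q)` is the quotient of `SL_n(F)`
by its center. -/
theorem stmt_5 (n q : ℕ) (hn : 2 ≤ n) (F : Type*) [Field F] [Fintype F]
    (hq : Fintype.card F = q) :
    q ^ (n ^ 2 - 2) <
        Nat.card (Matrix.SpecialLinearGroup (Fin n) F ⧸
          Subgroup.center (Matrix.SpecialLinearGroup (Fin n) F)) ∧
      Nat.card (Matrix.SpecialLinearGroup (Fin n) F ⧸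
          Subgroup.center (Matrix.SpecialLinearGroup (Fin n) F)) < q ^ (n ^ 2 - 1) := by
  classical
  have hGL := Matrix.card_GL_field (𝔽 := F) n
  rw [aux_card_SL n hn F,
    Subgroup.card_eq_card_quotient_mul_card_subgroup
      (Subgroup.center (Matrix.SpecialLinearGroup (Fin n) F)), hq] at hGL
  have hq2 : 2 ≤ q := by rw [← hq]; exact Fintype.one_lt_card
  have hu : Nat.card Fˣ = q - 1 := by
    rw [Nat.card_eq_fintype_card, Fintype.card_units, hq]
  have hd : Nat.card (Subgroup.center (Matrix.SpecialLinearGroup (Fin n) F)) ≤ q - 1 := by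
    rw [← hu, Nat.card_congr
      (Matrix.SpecialLinearGroup.center_equiv_rootsOfUnity' (⟨0, by omega⟩ : Fin n)).toEquiv]
    exact Subgroup.card_le_card_group _
  have hd1 : 0 < Nat.card (Subgroup.center (Matrix.SpecialLinearGroup (Fin n) F)) :=
    Nat.card_pos
  rw [hu] at hGL
  generalize Nat.card (Subgroup.center (Matrix.SpecialLinearGroup (Fin n) F)) = d at *
  generalize Nat.card (Matrix.SpecialLinearGroup (Fin n) F ⧸
          Subgroup.center (Matrix.SpecialLinearGroup (Fin n) F)) = N at *
  have hx : (2 : ℝ) ≤ q := by exact_mod_cast hq2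
  have hGL' : (N : ℝ) * d * (q - 1) =
      ∏ i ∈ Finset.range n, ((q : ℝ) ^ n - (q : ℝ) ^ i) := by
    rw [Fin.prod_univ_eq_prod_range (fun i => q ^ n - q ^ i) n] at hGL
    have h := congrArg (Nat.cast : ℕ → ℝ) hGL
    rw [Nat.cast_prod, Nat.cast_mul, Nat.cast_mul, Nat.cast_sub (by omega)] at h
    rw [Nat.cast_one] at h
    rw [h]
    refine Finset.prod_congr rfl fun i hi => ?_
    rw [Nat.cast_sub (Nat.pow_le_pow_right (by omega) (Finset.mem_range.1 hi).le)]
    push_cast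
    rfl
  have hdr : (d : ℝ) ≤ q - 1 := by
    have : d + 1 ≤ q := by omega
    have : (d : ℝ) + 1 ≤ q := by exact_mod_cast this
    linarith
  have hd1r : (1 : ℝ) ≤ d := by exact_mod_cast hd1
  have hlow := aux_lower q hx n (by omega)
  have hup : (∏ i ∈ Finset.range n, ((q : ℝ) ^ n - (q : ℝ) ^ i)) * q
      < (q : ℝ) ^ (n ^ 2) * (q - 1) := by
    obtain ⟨m, rfl⟩ : ∃ m, n = m + 1 := ⟨n - 1, by omega⟩
    exact aux_upper_step q hx m (aux_upper q hx m (by omega)) (by omega)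
  rw [← hGL'] at hlow hup
  have hn4 : 4 ≤ n ^ 2 := by nlinarith
  have hx0 : (0 : ℝ) < q - 1 := by linarith
  have hxx : (0 : ℝ) < q := by linarith
  have hy : (0 : ℝ) < (q : ℝ) ^ n := by positivity
  have hN : (0 : ℝ) ≤ N := by positivity
  constructor
  · have e : (q : ℝ) ^ (n ^ 2) = (q : ℝ) ^ (n ^ 2 - 2) * q ^ 2 := by
      rw [← pow_add]; congr 1; omega
    have hB : (0 : ℝ) < (q : ℝ) ^ (n ^ 2 - 2) := by positivity
    have : (q : ℝ) ^ (n ^ 2 - 2) < N := by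
      rw [e] at hlow
      generalize (q : ℝ) ^ (n ^ 2 - 2) = B at *
      generalize (q : ℝ) ^ n = y at *
      by_contra hc
      push Not at hc
      have h1 : (N : ℝ) * d ≤ B * (q - 1) := by gcongr
      have h2 := mul_le_mul_of_nonneg_left h1
        (by positivity : (0 : ℝ) ≤ (q - 1) * y * q ^ 2)
      have h3 : 0 < B * q ^ 2 * (q - 1) * q := by positivity
      linarith [h2, h3, hlow, show B * (q:ℝ) ^ 2 * (q - 1) * (q * y - y + q)
        = (q - 1) * y * q ^ 2 * (B * (q - 1)) + B * q ^ 2 * (q - 1) * q by ring,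
        show (N:ℝ) * d * (q - 1) * y * q ^ 2 = (q - 1) * y * q ^ 2 * (N * d) by ring]
    exact_mod_cast this
  · have e : (q : ℝ) ^ (n ^ 2) = (q : ℝ) ^ (n ^ 2 - 1) * q := by
      rw [← pow_succ]; congr 1; omega
    have : (N : ℝ) < (q : ℝ) ^ (n ^ 2 - 1) := by
      rw [e] at hup
      generalize (q : ℝ) ^ (n ^ 2 - 1) = B at *
      have h1 : (N : ℝ) * d * ((q - 1) * q) < B * ((q - 1) * q) := by linarith
      have h2 := lt_of_mul_lt_mul_right h1 (by positivity)
      nlinarith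
    exact_mod_cast this
end

section
/- Let m ≥ 2 be an integer and let F be a finite field with q elements. Then q^{m(2m+1)} < 4·|PSp_{2m}(q)| and |PSp_{2m}(q)| < q^{m(2m+1)}, where PSp_{2m}(q) denotes the quotient of the symplectic group Sp_{2m}(q) by its center. -/
open Matrix

namespace SpCount

/-- The type of symplectic bases of `V` indexed by `Fin m`. -/
abbrev SB {F : Type*} [Field F] (V : Type*) [AddCommGroup V] [Module F V]
    (ω : V →ₗ[F] V →ₗ[F] F) (m : ℕ) : Type _ :=
  {p : (Fin m → V) × (Fin m → V) // ∀ i j, ω (p.1 i) (p.1 j) = 0 ∧ ω (p.2 i) (p.2 j) = 0 ∧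
    ω (p.1 i) (p.2 j) = if i = j then 1 else 0}

section

variable {F : Type*} [Field F] {V : Type*} [AddCommGroup V] [Module F V]

/-- The common orthogonal complement of `e` and `f`. -/
def perp (ω : V →ₗ[F] V →ₗ[F] F) (e f : V) : Submodule F V :=
  LinearMap.ker ((ω e).prod (ω f))

lemma mem_perp (ω : V →ₗ[F] V →ₗ[F] F) (e f x : V) :
    x ∈ perp ω e f ↔ ω e x = 0 ∧ ω f x = 0 := by
  simp [perp]

lemma skew (ω : V →ₗ[F] V →ₗ[F] F) (halt : ∀ x, ω x x = 0) (x y : V) : ω x y = - ω y x := by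
  have h := halt (x + y)
  simp only [map_add, LinearMap.add_apply, halt] at h
  linear_combination h

lemma card_eq_of_surj {W : Type*} [AddCommGroup W] [Module F W] [Finite V]
    (g : V →ₗ[F] W) (hg : Function.Surjective g) :
    Nat.card V = Nat.card W * Nat.card (LinearMap.ker g) := by
  rw [Submodule.card_eq_card_quotient_mul_card (LinearMap.ker g),
    Nat.card_congr (g.quotKerEquivOfSurjective hg).toEquiv]
  ring

lemma card_fiber {W : Type*} [AddCommGroup W] [Module F W]
    (g : V →ₗ[F] W) (hg : Function.Surjective g) (w : W) :
    Nat.card {y // g y = w} = Nat.card (LinearMap.ker g) := by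
  obtain ⟨v, hv⟩ := hg w
  refine Nat.card_congr
    { toFun := fun y => ⟨y.1 - v, by simp [y.2, hv]⟩
      invFun := fun y => ⟨y.1 + v, by
        have := y.2
        rw [LinearMap.mem_ker] at this
        simp [hv, this]⟩
      left_inv := fun y => by simp
      right_inv := fun y => by simp }

lemma surj_of_ne (g : V →ₗ[F] F) (y : V) (hy : g y ≠ 0) : Function.Surjective g := by
  intro c
  refine ⟨(c / g y) • y, ?_⟩
  simp [hy]

lemma card_pairs [Fintype F] [Finite V] (ω : V →ₗ[F] V →ₗ[F] F)
    (hnd : ∀ x, (∀ y, ω x y = 0) → x = 0) (n : ℕ)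
    (hc : Nat.card V = Fintype.card F ^ (n + 1)) :
    Nat.card {p : V × V // ω p.1 p.2 = 1} =
      (Fintype.card F ^ (n + 1) - 1) * Fintype.card F ^ n := by
  have hF : 0 < Fintype.card F := Fintype.card_pos
  let E : {p : V × V // ω p.1 p.2 = 1} ≃ Σ x : {x : V // x ≠ 0}, {y : V // ω x.1 y = 1} :=
    { toFun := fun p => ⟨⟨p.1.1, fun h => by
          have := p.2
          rw [h] at this
          simp at this⟩, ⟨p.1.2, p.2⟩⟩
      invFun := fun s => ⟨(s.1.1, s.2.1), s.2.2⟩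
      left_inv := fun p => rfl
      right_inv := fun s => rfl }
  have hfib : ∀ x : {x : V // x ≠ 0}, Nat.card {y : V // ω x.1 y = 1} = Fintype.card F ^ n := by
    intro x
    have : ∃ y, ω x.1 y ≠ 0 := by
      by_contra! h
      exact x.2 (hnd _ h)
    obtain ⟨y, hy⟩ := this
    have hs := surj_of_ne _ y hy
    rw [card_fiber _ hs]
    have := card_eq_of_surj _ hs
    rw [hc, Nat.card_eq_fintype_card (α := F), pow_succ, mul_comm] at this
    exact (Nat.eq_of_mul_eq_mul_left hF this).symm
  rw [Nat.card_congr E]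
  have : Fintype {x : V // x ≠ 0} := Fintype.ofFinite _
  rw [Nat.card_sigma]
  simp only [hfib, Finset.sum_const, smul_eq_mul, Finset.card_univ]
  congr 1
  rw [← hc, ← Nat.card_eq_fintype_card]
  classical
  have h := Nat.card_congr (Equiv.sumCompl (fun x : V => x = 0))
  rw [Nat.card_sum, Nat.card_unique] at h
  simp only [ne_eq]
  omega

/-- Restriction of the form to the orthogonal complement. -/
def res (ω : V →ₗ[F] V →ₗ[F] F) (W : Submodule F V) : W →ₗ[F] W →ₗ[F] F :=
  ω.compl₁₂ W.subtype W.subtype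

@[simp] lemma res_apply (ω : V →ₗ[F] V →ₗ[F] F) (W : Submodule F V) (x y : W) :
    res ω W x y = ω x y := rfl

lemma card_perp [Fintype F] [Finite V] (ω : V →ₗ[F] V →ₗ[F] F) (halt : ∀ x, ω x x = 0)
    (e f : V) (hef : ω e f = 1) (n : ℕ) (hc : Nat.card V = Fintype.card F ^ (n + 2)) :
    Nat.card (perp ω e f) = Fintype.card F ^ n := by
  have hF : 0 < Fintype.card F := Fintype.card_pos
  have hs : Function.Surjective ((ω e).prod (ω f)) := by
    rintro ⟨a, b⟩
    refine ⟨a • f - b • e, ?_⟩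
    have hfe : ω f e = -1 := by rw [skew ω halt, hef]
    simp [halt, hef, hfe]
  have := card_eq_of_surj _ hs
  rw [hc, Nat.card_prod, Nat.card_eq_fintype_card (α := F)] at this
  have h2 : (Fintype.card F * Fintype.card F) * Fintype.card F ^ n
      = (Fintype.card F * Fintype.card F) * Nat.card (perp ω e f) := by
    rw [perp, ← this]; ring
  exact (Nat.eq_of_mul_eq_mul_left (by positivity) h2).symm

lemma nondeg_perp (ω : V →ₗ[F] V →ₗ[F] F) (halt : ∀ x, ω x x = 0)
    (hnd : ∀ x, (∀ y, ω x y = 0) → x = 0)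
    (e f : V) (hef : ω e f = 1) (x : perp ω e f)
    (hx : ∀ y, res ω (perp ω e f) x y = 0) : x = 0 := by
  have hfe : ω f e = -1 := by rw [skew ω halt, hef]
  obtain ⟨x, hxm⟩ := x
  have hxm' := (mem_perp _ _ _ _).1 hxm
  have hxe : ω x e = 0 := by rw [skew ω halt, hxm'.1, neg_zero]
  have hxf : ω x f = 0 := by rw [skew ω halt, hxm'.2, neg_zero]
  ext
  refine hnd _ fun y => ?_
  have hw : y - ω e y • f + ω f y • e ∈ perp ω e f := by
    rw [mem_perp]
    simp [halt, hef, hfe]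
  have := hx ⟨_, hw⟩
  simpa [hxe, hxf] using this

/-- Splitting off the first hyperbolic pair. -/
def splitEquiv (ω : V →ₗ[F] V →ₗ[F] F) (halt : ∀ x, ω x x = 0) (m : ℕ) :
    SB V ω (m + 1) ≃ Σ p : {p : V × V // ω p.1 p.2 = 1},
      SB (perp ω p.1.1 p.1.2) (res ω (perp ω p.1.1 p.1.2)) m where
  toFun s := ⟨⟨(s.1.1 0, s.1.2 0), by simpa using (s.2 0 0).2.2⟩,
    ⟨(fun i => ⟨s.1.1 i.succ, (mem_perp _ _ _ _).2 ⟨(s.2 0 i.succ).1, by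
        rw [skew ω halt, (s.2 i.succ 0).2.2]; simp⟩⟩,
      fun i => ⟨s.1.2 i.succ, (mem_perp _ _ _ _).2 ⟨by
        rw [(s.2 0 i.succ).2.2]; simp [(Fin.succ_ne_zero i).symm], (s.2 0 i.succ).2.1⟩⟩), by
      intro i j
      have := s.2 i.succ j.succ
      simpa using this⟩⟩
  invFun t := ⟨(Fin.cons t.1.1.1 (fun i => (t.2.1.1 i : V)),
      Fin.cons t.1.1.2 (fun i => (t.2.1.2 i : V))), by
    obtain ⟨⟨⟨e, f⟩, hef⟩, ⟨⟨a, b⟩, h⟩⟩ := t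
    have ha := fun i => (mem_perp _ _ _ _).1 (a i).2
    have hb := fun i => (mem_perp _ _ _ _).1 (b i).2
    have hae : ∀ i, ω (a i) e = 0 := fun i => by rw [skew ω halt, (ha i).1, neg_zero]
    have haf : ∀ i, ω (a i) f = 0 := fun i => by rw [skew ω halt, (ha i).2, neg_zero]
    have hbf : ∀ i, ω (b i) f = 0 := fun i => by rw [skew ω halt, (hb i).2, neg_zero]
    simp only [res_apply] at h ha hb hef
    intro i j
    refine Fin.cases ?_ (fun i => ?_) i <;> refine Fin.cases ?_ (fun j => ?_) j
    · simp [halt, hef]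
    · simp [(ha j).1, (hb j).1, (hb j).2, (Fin.succ_ne_zero j).symm]
    · simp [hae, haf, hbf]
    · simpa using h i j⟩
  left_inv s := by
    apply Subtype.ext
    refine Prod.ext ?_ ?_ <;> funext i <;> refine Fin.cases ?_ (fun i => ?_) i <;> rfl
  right_inv t := rfl

end

theorem card_SB {F : Type*} [Field F] [Fintype F] (m : ℕ) :
    ∀ (V : Type _) [AddCommGroup V] [Module F V] [Finite V]
      (ω : V →ₗ[F] V →ₗ[F] F) (_ : ∀ x, ω x x = 0)
      (_ : ∀ x, (∀ y, ω x y = 0) → x = 0)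
      (_ : Nat.card V = Fintype.card F ^ (2 * m)),
      Nat.card (SB V ω m) = ∏ i ∈ Finset.range m,
        ((Fintype.card F ^ (2 * i + 2) - 1) * Fintype.card F ^ (2 * i + 1)) := by
  induction m with
  | zero =>
    intro V _ _ _ ω _ _ _
    have : Unique (SB V ω 0) :=
      { default := ⟨(Fin.elim0, Fin.elim0), fun i => i.elim0⟩
        uniq := fun a => Subtype.ext (Subsingleton.elim _ _) }
    simp
  | succ m ih =>
    intro V _ _ _ ω halt hnd hc
    rw [Nat.card_congr (splitEquiv ω halt m)]
    have : Fintype {p : V × V // ω p.1 p.2 = 1} := Fintype.ofFinite _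
    have hfin : ∀ p : {p : V × V // ω p.1 p.2 = 1},
        Finite (SB (perp ω p.1.1 p.1.2) (res ω (perp ω p.1.1 p.1.2)) m) := by
      intro p; unfold SB; infer_instance
    rw [Nat.card_sigma]
    have key : ∀ p : {p : V × V // ω p.1 p.2 = 1},
        Nat.card (SB (perp ω p.1.1 p.1.2) (res ω (perp ω p.1.1 p.1.2)) m) =
        ∏ i ∈ Finset.range m,
        ((Fintype.card F ^ (2 * i + 2) - 1) * Fintype.card F ^ (2 * i + 1)) := by
      intro p
      have hcW := card_perp ω halt _ _ p.2 (2 * m) (by rw [hc, Nat.mul_succ])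
      exact ih (perp ω p.1.1 p.1.2) (res ω (perp ω p.1.1 p.1.2))
        (fun x => halt _) (nondeg_perp ω halt hnd _ _ p.2) hcW
    rw [Finset.sum_congr rfl (fun p _ => key p)]
    rw [Finset.sum_const, smul_eq_mul, Finset.card_univ, ← Nat.card_eq_fintype_card,
      card_pairs ω hnd (2 * m + 1) (by rw [hc, Nat.mul_succ]), Finset.prod_range_succ, mul_comm]

/-- The standard form. -/
noncomputable def stdForm (F : Type*) [Field F] (m : ℕ) :
    (Fin m ⊕ Fin m → F) →ₗ[F] (Fin m ⊕ Fin m → F) →ₗ[F] F :=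
  Matrix.toLinearMap₂' F (J (Fin m) F)

lemma stdForm_apply (F : Type*) [Field F] (m : ℕ) (v w : Fin m ⊕ Fin m → F) :
    stdForm F m v w = v ⬝ᵥ (J (Fin m) F *ᵥ w) := by
  simp [stdForm, Matrix.toLinearMap₂'_apply']

lemma stdForm_apply' (F : Type*) [Field F] (m : ℕ) (v w : Fin m ⊕ Fin m → F) :
    stdForm F m v w = ∑ i, (v (Sum.inr i) * w (Sum.inl i) - v (Sum.inl i) * w (Sum.inr i)) := by
  rw [stdForm_apply, J, Matrix.fromBlocks_mulVec]
  simp [dotProduct, Fintype.sum_sum_type, Matrix.neg_mulVec, Finset.sum_sub_distrib]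
  ring

lemma entry (F : Type*) [Field F] (m : ℕ) (M : Matrix (Fin m ⊕ Fin m) (Fin m ⊕ Fin m) F) (a b) :
    (M * J (Fin m) F * Mᵀ) a b = stdForm F m (M a) (M b) := by
  rw [stdForm_apply, Matrix.mul_assoc, Matrix.mul_apply]
  rfl

/-- Symplectic matrices are symplectic bases. -/
noncomputable def matEquiv (F : Type*) [Field F] (m : ℕ) :
    symplecticGroup (Fin m) F ≃ SB (Fin m ⊕ Fin m → F) (stdForm F m) m where
  toFun M := ⟨(fun i => M.1 (Sum.inr i), fun i => M.1 (Sum.inl i)), by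
    intro i j
    have h := SymplecticGroup.mem_iff.1 M.2
    simp only [← entry, h]
    simp [J, Matrix.one_apply]⟩
  invFun s := ⟨Matrix.of (Sum.elim s.1.2 s.1.1), by
    have halt : ∀ x, stdForm F m x x = 0 := fun x => by
      rw [stdForm_apply']; simp [mul_comm]
    rw [SymplecticGroup.mem_iff]
    ext a b
    rw [entry]
    have hl : ∀ i, Matrix.of (Sum.elim s.1.2 s.1.1) (Sum.inl i) = s.1.2 i := fun _ => rfl
    have hr : ∀ i, Matrix.of (Sum.elim s.1.2 s.1.1) (Sum.inr i) = s.1.1 i := fun _ => rfl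
    rcases a with i | i <;> rcases b with j | j
    · simpa [J, hl, hr] using (s.2 i j).2.1
    · have := (s.2 j i).2.2
      rw [skew _ halt, hl, hr, this]
      simp [J, Matrix.one_apply, eq_comm]
    · have := (s.2 i j).2.2
      rw [hl, hr, this]
      simp [J, Matrix.one_apply]
    · simpa [J, hl, hr] using (s.2 i j).1⟩
  left_inv M := by
    apply Subtype.ext
    funext a
    rcases a with i | i <;> rfl
  right_inv s := rfl

theorem card_Sp (F : Type*) [Field F] [Fintype F] (m : ℕ) :
    Nat.card (symplecticGroup (Fin m) F) = ∏ i ∈ Finset.range m,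
        ((Fintype.card F ^ (2 * i + 2) - 1) * Fintype.card F ^ (2 * i + 1)) := by
  rw [Nat.card_congr (matEquiv F m)]
  apply card_SB
  · intro x
    rw [stdForm_apply']; simp [mul_comm]
  · intro x hx
    funext a
    rcases a with i | i
    · have := hx (Pi.single (Sum.inr i) 1)
      simpa [stdForm_apply', Pi.single_apply] using this
    · have := hx (Pi.single (Sum.inl i) 1)
      simpa [stdForm_apply', Pi.single_apply] using this
  · simp [Nat.card_eq_fintype_card, two_mul]

lemma aux_ineq (x : ℝ) (hx0 : 0 < x) (hx : x ≤ 1 / 4) (m : ℕ) :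
    1 / 2 + x ^ (m + 1) ≤ ∏ i ∈ Finset.range (m + 1), (1 - x ^ (i + 1)) := by
  induction m with
  | zero => simp; linarith
  | succ m ih =>
    rw [Finset.prod_range_succ]
    have hy0 : 0 < x ^ (m + 1) := by positivity
    have hy1 : x ^ (m + 1) ≤ x := by
      calc x ^ (m + 1) ≤ x ^ 1 := pow_le_pow_of_le_one hx0.le (by linarith) (by omega)
        _ = x := pow_one x
    have hz : x ^ (m + 1 + 1) = x ^ (m + 1) * x := pow_succ _ _
    rw [hz]
    set y := x ^ (m + 1)
    have h1 : 0 ≤ 1 - y * x := by nlinarith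
    refine le_trans ?_ (mul_le_mul_of_nonneg_right ih h1)
    have : 0 ≤ y * (1 - 3 * x / 2 - y * x) := by
      apply mul_nonneg hy0.le
      nlinarith
    nlinarith

lemma aux_eq (q : ℕ) (hq : 2 ≤ q) (m : ℕ) :
    ((∏ i ∈ Finset.range m, ((q ^ (2 * i + 2) - 1) * q ^ (2 * i + 1)) : ℕ) : ℝ) =
      (q : ℝ) ^ (m * (2 * m + 1)) *
        ∏ i ∈ Finset.range m, (1 - (((q : ℝ) ^ 2)⁻¹) ^ (i + 1)) := by
  have hq0 : (q : ℝ) ≠ 0 := by positivity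
  induction m with
  | zero => simp
  | succ m ih =>
    rw [Finset.prod_range_succ, Finset.prod_range_succ, Nat.cast_mul, ih, Nat.cast_mul,
      Nat.cast_sub (Nat.one_le_pow _ _ (by omega))]
    have e1 : (m + 1) * (2 * (m + 1) + 1) = m * (2 * m + 1) + (2 * m + 2) + (2 * m + 1) := by ring
    rw [e1, pow_add _ _ (2 * m + 1), pow_add _ _ (2 * m + 2)]
    have e2 : (1 - (((q : ℝ) ^ 2)⁻¹) ^ (m + 1)) * (q : ℝ) ^ (2 * m + 2)
        = (q : ℝ) ^ (2 * m + 2) - 1 := by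
      rw [inv_pow, ← pow_mul, show 2 * (m + 1) = 2 * m + 2 by ring]
      field_simp
    push_cast
    rw [← e2]
    ring

lemma bounds (q : ℕ) (hq : 2 ≤ q) (m : ℕ) (hm : 1 ≤ m) :
    q ^ (m * (2 * m + 1)) <
      2 * ∏ i ∈ Finset.range m, ((q ^ (2 * i + 2) - 1) * q ^ (2 * i + 1)) ∧
    ∏ i ∈ Finset.range m, ((q ^ (2 * i + 2) - 1) * q ^ (2 * i + 1)) < q ^ (m * (2 * m + 1)) := by
  have hq0 : (2 : ℝ) ≤ q := by exact_mod_cast hq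
  have hx0 : 0 < ((q : ℝ) ^ 2)⁻¹ := by positivity
  have hx : ((q : ℝ) ^ 2)⁻¹ ≤ 1 / 4 := by
    rw [one_div]
    apply inv_anti₀ (by norm_num)
    nlinarith
  have hN : 0 < (q : ℝ) ^ (m * (2 * m + 1)) := by positivity
  constructor
  · rw [← Nat.cast_lt (α := ℝ), Nat.cast_mul, aux_eq q hq]
    obtain ⟨k, rfl⟩ : ∃ k, m = k + 1 := ⟨m - 1, by omega⟩
    have h := aux_ineq _ hx0 hx k
    have h2 : 0 < (((q : ℝ) ^ 2)⁻¹) ^ (k + 1) := by positivity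
    push_cast
    nlinarith
  · rw [← Nat.cast_lt (α := ℝ), aux_eq q hq]
    push_cast
    apply mul_lt_of_lt_one_right hN
    have hb : ∀ i : ℕ, 0 < 1 - (((q : ℝ) ^ 2)⁻¹) ^ (i + 1) ∧
        1 - (((q : ℝ) ^ 2)⁻¹) ^ (i + 1) < 1 := by
      intro i
      have h1 : 0 < (((q : ℝ) ^ 2)⁻¹) ^ (i + 1) := by positivity
      have h2 : (((q : ℝ) ^ 2)⁻¹) ^ (i + 1) < 1 :=
        pow_lt_one₀ hx0.le (by linarith) (by omega)
      constructor <;> linarith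
    calc ∏ i ∈ Finset.range m, (1 - (((q : ℝ) ^ 2)⁻¹) ^ (i + 1))
        < ∏ i ∈ Finset.range m, (1 : ℝ) :=
          Finset.prod_lt_prod_of_nonempty (fun i _ => (hb i).1) (fun i _ => (hb i).2)
            ⟨0, by simp; omega⟩
      _ = 1 := by simp

lemma center_eq (F : Type*) [Field F] (m : ℕ) (M : symplecticGroup (Fin m) F)
    (hM : M ∈ Subgroup.center (symplecticGroup (Fin m) F)) :
    M.1 = 1 ∨ M.1 = -1 := by
  rw [Subgroup.mem_center_iff] at hM
  obtain ⟨M, hMs⟩ := M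
  obtain ⟨A, B, C, D, rfl⟩ : ∃ A B C D, M = fromBlocks A B C D :=
    ⟨_, _, _, _, (fromBlocks_toBlocks M).symm⟩
  have hup : ∀ S : Matrix (Fin m) (Fin m) F, Sᵀ = S →
      fromBlocks 1 S 0 1 * fromBlocks A B C D = fromBlocks A B C D * fromBlocks 1 S 0 1 := by
    intro S hS
    have hmem : fromBlocks 1 S 0 1 ∈ symplecticGroup (Fin m) F := by
      rw [SymplecticGroup.fromBlocks_mem_iff]
      simp [hS]
    exact congrArg Subtype.val (hM ⟨_, hmem⟩)
  have hlo : fromBlocks 1 0 1 1 * fromBlocks A B C D = fromBlocks A B C D * fromBlocks 1 0 1 1 := by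
    have hmem : fromBlocks 1 0 1 1 ∈ symplecticGroup (Fin m) F := by
      rw [SymplecticGroup.fromBlocks_mem_iff]
      simp
    exact congrArg Subtype.val (hM ⟨_, hmem⟩)
  have h1 := hup 1 (by simp)
  simp only [fromBlocks_multiply, fromBlocks_inj, one_mul, mul_one, zero_mul, mul_zero, add_zero,
    zero_add] at h1 hlo
  have hC : C = 0 := by simpa using h1.1
  have hB : B = 0 := by simpa using hlo.1
  have hD : D = A := by
    have := h1.2.1
    rw [hB] at this
    simpa using this
  subst hC hB hD
  have hcomm : ∀ S : Matrix (Fin m) (Fin m) F, Sᵀ = S → Commute S D := by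
    intro S hS
    have := hup S hS
    simp only [fromBlocks_multiply, fromBlocks_inj, one_mul, mul_one, zero_mul, mul_zero, add_zero,
      zero_add] at this
    exact this.2.1
  have hsc : D ∈ Set.range (Matrix.scalar (Fin m)) := by
    apply Matrix.mem_range_scalar_of_commute_single
    intro i j hij
    have ha := hcomm (single i i 1) (by simp)
    have hb := hcomm (single i j 1 + single j i 1) (by simp [add_comm])
    have := ha.mul_left hb
    simpa [mul_add, hij] using this
  obtain ⟨c, rfl⟩ := hsc
  have hDD := (SymplecticGroup.fromBlocks_mem_iff.1 hMs).2.2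
  rcases isEmpty_or_nonempty (Fin m) with he | ⟨⟨i⟩⟩
  · left
    exact Subsingleton.elim _ _
  have hcc : c * c = 1 := by
    have := congrFun (congrFun hDD i) i
    simpa using this
  rcases mul_self_eq_one_iff.1 hcc with rfl | rfl
  · left
    simp
  · right
    have hs : scalar (Fin m) (-1 : F) = -1 := by rw [map_neg, map_one]
    rw [← fromBlocks_one, fromBlocks_neg]
    simp only [hs, neg_zero]

lemma card_center (F : Type*) [Field F] [Fintype F] (m : ℕ) :
    Nat.card (Subgroup.center (symplecticGroup (Fin m) F)) ≤ 2 := by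
  let g : Subgroup.center (symplecticGroup (Fin m) F) →
      ({1, -1} : Set (Matrix (Fin m ⊕ Fin m) (Fin m ⊕ Fin m) F)) :=
    fun M => ⟨M.1.1, center_eq F m M.1 M.2⟩
  have hg : Function.Injective g := by
    intro a b h
    exact Subtype.ext (Subtype.ext (Subtype.mk.inj h))
  refine (Nat.card_le_card_of_injective g hg).trans ?_
  rw [Nat.card_coe_set_eq]
  exact (Set.ncard_insert_le _ _).trans (by simp)

end SpCount

/-- For `m ≥ 2` and a finite field `F` with `q` elements,
`q^{m(2m+1)} < 4·|PSp_{2m}(q)|` and `|PSp_{2m}(q)| < q^{m(2m+1)}`, where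
`PSp_{2m}(q)` is the quotient of the symplectic group `Sp_{2m}(q)` by its center. -/
theorem stmt_6 (m q : ℕ) (hm : 2 ≤ m) (F : Type*) [Field F] [Fintype F]
    (hq : Fintype.card F = q) :
    q ^ (m * (2 * m + 1)) <
        4 * Nat.card (↥(Matrix.symplecticGroup (Fin m) F) ⧸
          Subgroup.center ↥(Matrix.symplecticGroup (Fin m) F)) ∧
      Nat.card (↥(Matrix.symplecticGroup (Fin m) F) ⧸
          Subgroup.center ↥(Matrix.symplecticGroup (Fin m) F)) < q ^ (m * (2 * m + 1)) := by
  subst hq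
  have hq2 : 2 ≤ Fintype.card F := Fintype.one_lt_card
  have hb := SpCount.bounds (Fintype.card F) hq2 m (by omega)
  rw [← SpCount.card_Sp] at hb
  have hz := SpCount.card_center F m
  have hz0 : 0 < Nat.card (Subgroup.center (Matrix.symplecticGroup (Fin m) F)) := Nat.card_pos
  have hl := Subgroup.card_eq_card_quotient_mul_card_subgroup
    (Subgroup.center (Matrix.symplecticGroup (Fin m) F))
  constructor
  · nlinarith [hb.1]
  · nlinarith [hb.2]
end

section
/- Let r be a prime, let q be a prime power such that r^{gcd(2,r)} divides q − 1 (that is, r divides q − 1, and moreover 4 divides q − 1 in case r = 2), and let n ≥ 1. Then log_r(|GL_n(q)|_r) < n·log_r(q − 1) + n/(r − 1); equivalently, the r-adic valuation ν_r(|GL_n(q)|) satisfies ν_r(|GL_n(q)|) < n·log_r(q − 1) + n/(r − 1) as real numbers. -/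
lemma val_pow_sub_one (r q k : ℕ) (hr : r.Prime) (hq : 1 < q)
    (hdvd : r ^ Nat.gcd 2 r ∣ q - 1) (hk : k ≠ 0) :
    padicValNat r (q ^ k - 1) = padicValNat r (q - 1) + padicValNat r k := by
  have := Fact.mk hr
  have hg : Nat.gcd 2 r ≠ 0 := by simp
  have hd : r ∣ q - 1 := (dvd_pow_self r hg).trans hdvd
  have hrq : ¬ r ∣ q := by
    intro h
    have h1 := Nat.dvd_sub h hd
    rw [show q - (q - 1) = 1 by omega] at h1
    exact hr.one_lt.ne' (Nat.dvd_one.mp h1)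
  rcases hr.eq_two_or_odd' with rfl | hodd
  · have h4 : 4 ∣ q - 1 := by simpa using hdvd
    rcases Nat.even_or_odd k with he | ho
    · have h := padicValNat.pow_two_sub_one hq hrq hk he
      have h2 : padicValNat 2 (q + 1) = 1 := by
        obtain ⟨m, hm⟩ := h4
        have : q + 1 = 2 * (2 * m + 1) := by omega
        rw [this, padicValNat.mul (by norm_num) (by omega), padicValNat.self (by norm_num),
          padicValNat.eq_zero_of_not_dvd (by omega)]
      omega
    · have hge : (q - 1) * ∑ i ∈ Finset.range k, q ^ i = q ^ k - 1 := by
        have h1 : 1 ≤ q ^ k := Nat.one_le_pow _ _ (by omega)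
        zify [hq.le, h1]
        exact mul_geom_sum (q : ℤ) k
      have hso : ¬ 2 ∣ ∑ i ∈ Finset.range k, q ^ i := by
        have hqo : Odd q := by rw [← Nat.not_even_iff_odd, even_iff_two_dvd]; exact hrq
        rw [← even_iff_two_dvd, Nat.not_even_iff_odd, Finset.odd_sum_iff_odd_card_odd,
          Finset.filter_true_of_mem (fun i _ => hqo.pow), Finset.card_range]
        exact ho
      rw [← hge, padicValNat.mul (by omega) (by rintro h0; simp [h0] at hso),
        padicValNat.eq_zero_of_not_dvd hso, padicValNat.eq_zero_of_not_dvd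
          (Nat.two_dvd_ne_zero.mpr (Nat.odd_iff.mp ho))]
  · have h := padicValNat.pow_sub_pow hodd (y := 1) hq hd hrq hk
    simpa using h

lemma val_prod (r q n : ℕ) (hr : r.Prime) (hq : 1 < q)
    (hdvd : r ^ Nat.gcd 2 r ∣ q - 1) :
    padicValNat r (∏ i ∈ Finset.range n, (q ^ n - q ^ i)) =
      n * padicValNat r (q - 1) + padicValNat r n.factorial := by
  have := Fact.mk hr
  have hg : Nat.gcd 2 r ≠ 0 := by simp
  have hd : r ∣ q - 1 := (dvd_pow_self r hg).trans hdvd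
  have hrq : ¬ r ∣ q := by
    intro h
    have h1 := Nat.dvd_sub h hd
    rw [show q - (q - 1) = 1 by omega] at h1
    exact hr.one_lt.ne' (Nat.dvd_one.mp h1)
  induction n with
  | zero => simp
  | succ n ih =>
    have h1 : ∀ i, q ^ (n + 1) - q ^ (i + 1) = q * (q ^ n - q ^ i) := by
      intro i; rw [Nat.mul_sub, pow_succ', pow_succ']
    have hne : ∏ i ∈ Finset.range n, (q ^ n - q ^ i) ≠ 0 := by
      rw [Finset.prod_ne_zero_iff]
      intro i hi
      have := Nat.pow_lt_pow_right hq (Finset.mem_range.mp hi)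
      omega
    have hne2 : q ^ (n + 1) - 1 ≠ 0 := by
      have := Nat.one_lt_pow (n.succ_ne_zero) hq
      simp only [Nat.succ_eq_add_one] at this
      omega
    rw [Finset.prod_range_succ', pow_zero]
    simp only [h1, Finset.prod_mul_distrib, Finset.prod_const, Finset.card_range]
    have hqn : q ^ n ≠ 0 := by positivity
    rw [padicValNat.mul (mul_ne_zero hqn hne) hne2, padicValNat.mul hqn hne, ih,
      val_pow_sub_one r q (n + 1) hr hq hdvd (by omega), 
      padicValNat.eq_zero_of_not_dvd (fun h => hrq (hr.dvd_of_dvd_pow h)), Nat.factorial_succ,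
      padicValNat.mul (by omega) (Nat.factorial_ne_zero n)]
    ring

/-- Let `r` be a prime, `q` a prime power with `r^{gcd(2,r)} ∣ q − 1`,
and `n ≥ 1`. Then `ν_r(|GL_n(q)|) < n·log_r(q − 1) + n/(r − 1)` as real numbers. -/
theorem stmt_7 (r q n : ℕ) (hr : r.Prime) (hq : IsPrimePow q)
    (hdvd : r ^ Nat.gcd 2 r ∣ q - 1) (hn : 1 ≤ n)
    (F : Type*) [Field F] [Fintype F] (hF : Fintype.card F = q) :
    ((Nat.card (GL (Fin n) F)).factorization r : ℝ) <
      (n : ℝ) * Real.logb r ((q - 1 : ℕ) : ℝ) + (n : ℝ) / ((r : ℝ) - 1) := by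
  have := Fact.mk hr
  have hq1 := hq.one_lt
  rw [Matrix.card_GL_field, hF, Nat.factorization_def _ hr,
    Fin.prod_univ_eq_prod_range (fun i => q ^ n - q ^ i) n, val_prod r q n hr hq1 hdvd]
  have hr1 : (1 : ℝ) < r := by exact_mod_cast hr.one_lt
  have hfac := sub_one_mul_padicValNat_factorial_lt_of_ne_zero r (n := n) (by omega)
  have hfac' : (padicValNat r n.factorial : ℝ) < n / ((r : ℝ) - 1) := by
    rw [lt_div_iff₀ (by linarith)]
    have : (((r - 1) * padicValNat r n.factorial : ℕ) : ℝ) < n := by exact_mod_cast hfac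
    rw [Nat.cast_mul, Nat.cast_sub hr.one_lt.le] at this
    push_cast at this
    linarith
  have hlog : (padicValNat r (q - 1) : ℝ) ≤ Real.logb r ((q - 1 : ℕ) : ℝ) := by
    rw [Real.le_logb_iff_rpow_le hr1 (by exact_mod_cast (by omega : 0 < q - 1)), Real.rpow_natCast]
    exact_mod_cast Nat.le_of_dvd (by omega) pow_padicValNat_dvd
  push_cast [-Nat.cast_sub]
  have hn0 : (0 : ℝ) ≤ n := by positivity
  have := mul_le_mul_of_nonneg_left hlog hn0
  linarith
end

section
/- Let r be a prime, let q be a prime power such that r^{gcd(2,r)} divides q − 1 (that is, r divides q − 1, and moreover 4 divides q − 1 in case r = 2), and let n ≥ 1. Then the r-adic valuation of the order of GL_n(q) satisfies ν_r(|GL_n(q)|) = n·ν_r(q − 1) + ν_r(n!). -/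
theorem lte_aux (r q m : ℕ) (hr : r.Prime) (h1 : 1 < q)
    (hdvd : r ^ Nat.gcd 2 r ∣ q - 1) (hm : m ≠ 0) :
    (q ^ m - 1).factorization r = (q - 1).factorization r + m.factorization r := by
  haveI : Fact r.Prime := ⟨hr⟩
  have hpow : 1 < q ^ m := Nat.one_lt_pow hm h1
  have hrq1 : r ∣ q - 1 := by
    refine dvd_trans (dvd_pow_self r ?_) hdvd
    exact (Nat.gcd_pos_of_pos_left r (by norm_num)).ne'
  have hrq : ¬ r ∣ q := by
    intro h
    have h2 := Nat.dvd_sub h hrq1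
    rw [show q - (q - 1) = 1 by omega] at h2
    exact hr.one_lt.ne' (Nat.dvd_one.mp h2)
  rw [Nat.factorization_def _ hr, Nat.factorization_def _ hr, Nat.factorization_def _ hr]
  rcases hr.eq_two_or_odd' with h2 | hodd
  · subst h2
    have h4 : (4 : ℤ) ∣ (q : ℤ) - 1 := by
      have : 4 ∣ q - 1 := by simpa using hdvd
      omega
    have hx : ¬ (2 : ℤ) ∣ (q : ℤ) := by omega
    have key := Int.two_pow_sub_pow' (x := (q : ℤ)) (y := 1) m h4 hx
    rw [← Nat.cast_inj (R := ℕ∞), Nat.cast_add]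
    rw [padicValNat_eq_emultiplicity (by omega), padicValNat_eq_emultiplicity (by omega),
      padicValNat_eq_emultiplicity hm]
    rw [← Int.natCast_emultiplicity, ← Int.natCast_emultiplicity, ← Int.natCast_emultiplicity]
    rw [Nat.cast_sub hpow.le, Nat.cast_sub h1.le]
    simpa using key
  · have := padicValNat.pow_sub_pow (p := r) hodd (x := q) (y := 1) h1 hrq1 hrq hm
    simpa using this

/-- Let `r` be a prime, `q` a prime power with `r^{gcd(2,r)} ∣ q − 1`,
and `n ≥ 1`. Then `ν_r(|GL_n(q)|) = n·ν_r(q − 1) + ν_r(n!)`. -/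
theorem stmt_8 (r q n : ℕ) (hr : r.Prime) (hq : IsPrimePow q)
    (hdvd : r ^ Nat.gcd 2 r ∣ q - 1) (hn : 1 ≤ n)
    (F : Type*) [Field F] [Fintype F] (hF : Fintype.card F = q) :
    (Nat.card (GL (Fin n) F)).factorization r =
      n * (q - 1).factorization r + (Nat.factorial n).factorization r := by
  have h1 : 1 < q := hq.one_lt
  have hrq : ¬ r ∣ q := by
    intro h
    have hrq1 : r ∣ q - 1 := by
      refine dvd_trans (dvd_pow_self r ?_) hdvd
      exact (Nat.gcd_pos_of_pos_left r (by norm_num)).ne'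
    have h2 := Nat.dvd_sub h hrq1
    rw [show q - (q - 1) = 1 by omega] at h2
    exact hr.one_lt.ne' (Nat.dvd_one.mp h2)
  rw [Matrix.card_GL_field, hF, Fin.prod_univ_eq_prod_range (fun i => q ^ n - q ^ i) n]
  have hfac : n.factorial = ∏ i ∈ Finset.range n, (n - i) := by
    rw [← Finset.prod_range_add_one_eq_factorial, ← Finset.prod_range_reflect]
    refine Finset.prod_congr rfl fun i hi => ?_
    have := Finset.mem_range.mp hi
    omega
  rw [hfac, Nat.factorization_prod_apply, Nat.factorization_prod_apply]
  · have : ∀ i ∈ Finset.range n, (q ^ n - q ^ i).factorization r =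
        (q - 1).factorization r + (n - i).factorization r := by
      intro i hi
      have hi := Finset.mem_range.mp hi
      have hm : n - i ≠ 0 := by omega
      have hpow : 1 < q ^ (n - i) := Nat.one_lt_pow hm h1
      have e : q ^ n - q ^ i = q ^ i * (q ^ (n - i) - 1) := by
        rw [Nat.mul_sub, ← pow_add, mul_one, Nat.add_sub_cancel' hi.le]
      rw [e, Nat.factorization_mul (by positivity) (by omega), Finsupp.add_apply,
        lte_aux r q _ hr h1 hdvd hm, Nat.factorization_pow, Finsupp.smul_apply,
        Nat.factorization_eq_zero_of_not_dvd hrq]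
      simp
    rw [Finset.sum_congr rfl this, Finset.sum_add_distrib]
    simp
  · intro i hi
    have := Finset.mem_range.mp hi
    omega
  · intro i hi
    have := Nat.pow_lt_pow_right h1 (Finset.mem_range.mp hi)
    omega
end

section
/- Let q be a prime power with q ≡ 3 (mod 4), let n ≥ 1, and let F and F' be finite fields with |F| = q and |F'| = q². Then ν_2(|GL_n(F)|) = ⌈n/2⌉ + ν_2(|GL_{⌊n/2⌋}(F')|); that is, if n is even then ν_2(|GL_n(q)|) = n/2 + ν_2(|GL_{n/2}(q²)|), and if n is odd then ν_2(|GL_n(q)|) = (n+1)/2 + ν_2(|GL_{(n−1)/2}(q²)|). -/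
theorem aux_card (Q n : ℕ) (hQ : Q % 2 = 1) (hQ1 : 1 < Q) (F : Type*) [Field F] [Fintype F]
    (hF : Fintype.card F = Q) :
    (Nat.card (GL (Fin n) F)).factorization 2 =
      ∑ j ∈ Finset.range n, (Q ^ (j + 1) - 1).factorization 2 := by
  have hpos : ∀ j : ℕ, Q ^ (j + 1) - 1 ≠ 0 := by
    intro j
    have := Nat.one_lt_pow (Nat.succ_ne_zero j) hQ1
    simp only [Nat.succ_eq_add_one] at this
    omega
  have key : ∀ i ∈ Finset.range n,
      Q ^ n - Q ^ i = Q ^ i * (Q ^ ((n - 1 - i) + 1) - 1) := by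
    intro i hi
    have hi := Finset.mem_range.1 hi
    rw [Nat.mul_sub, ← pow_add, mul_one]
    congr 2
    omega
  rw [Matrix.card_GL_field, hF, Fin.prod_univ_eq_prod_range (fun i => Q ^ n - Q ^ i) n,
    Finset.prod_congr rfl key, Nat.factorization_prod]
  · rw [Finsupp.finset_sum_apply,
      ← Finset.sum_range_reflect (fun j => (Q ^ (j + 1) - 1).factorization 2)]
    refine Finset.sum_congr rfl fun i _ => ?_
    rw [Nat.factorization_mul (pow_ne_zero _ (by omega)) (hpos _), Finsupp.add_apply,
      Nat.factorization_eq_zero_of_not_dvd, zero_add]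
    intro h
    have := Nat.prime_two.dvd_of_dvd_pow h
    omega
  · intro i _
    exact mul_ne_zero (pow_ne_zero _ (by omega)) (hpos _)

theorem aux_odd (q m : ℕ) (hq : q % 4 = 3) : (q ^ (2 * m + 1) - 1).factorization 2 = 1 := by
  have h : q ^ (2 * m + 1) % 4 = 3 := by
    induction m with
    | zero => simpa using hq
    | succ m ih =>
      rw [show 2 * (m + 1) + 1 = (2 * m + 1) + 1 + 1 by ring, pow_succ, pow_succ]
      simp [Nat.mul_mod, ih, hq]
  obtain ⟨k, hk⟩ : ∃ k, q ^ (2 * m + 1) - 1 = 2 * (2 * k + 1) :=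
    ⟨(q ^ (2 * m + 1)) / 4, by omega⟩
  rw [hk, Nat.factorization_mul (by omega) (by omega), Finsupp.add_apply,
    Nat.prime_two.factorization_self, Nat.factorization_eq_zero_of_not_dvd (by omega)]

theorem aux_sum (q m : ℕ) (hq : q % 4 = 3) :
    ∑ j ∈ Finset.range (2 * m), (q ^ (j + 1) - 1).factorization 2 =
      m + ∑ j ∈ Finset.range m, ((q ^ 2) ^ (j + 1) - 1).factorization 2 := by
  induction m with
  | zero => simp
  | succ m ih =>
    rw [show 2 * (m + 1) = 2 * m + 1 + 1 by ring, Finset.sum_range_succ, Finset.sum_range_succ, ih,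
      aux_odd q m hq, Finset.sum_range_succ, ← pow_mul,
      show 2 * (m + 1) = 2 * m + 1 + 1 by ring]
    ring

/-- Let `q` be a prime power with `q ≡ 3 (mod 4)`, let `n ≥ 1`, and
let `F, F'` be finite fields with `|F| = q`, `|F'| = q²`. Then
`ν_2(|GL_n(F)|) = ⌈n/2⌉ + ν_2(|GL_{⌊n/2⌋}(F')|)`. -/
theorem stmt_10 (q n : ℕ) (hn : 1 ≤ n) (hq3 : q % 4 = 3)
    (F F' : Type*) [Field F] [Fintype F] [Field F'] [Fintype F']
    (hF : Fintype.card F = q) (hF' : Fintype.card F' = q ^ 2) :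
    (Nat.card (GL (Fin n) F)).factorization 2 =
      (n + 1) / 2 + (Nat.card (GL (Fin (n / 2)) F')).factorization 2 := by
  have h2 : q ^ 2 % 2 = 1 := by
    have : q % 2 = 1 := by omega
    simp [Nat.pow_mod, this]
  rw [aux_card q n (by omega) (by omega) F hF,
    aux_card (q ^ 2) (n / 2) h2 (Nat.one_lt_pow (by omega) (by omega)) F' hF']
  obtain h | h : n = 2 * (n / 2) ∨ n = 2 * (n / 2) + 1 := by omega
  · generalize n / 2 = m at h
    subst h
    rw [aux_sum q m hq3]
    congr 1
    omega
  · generalize n / 2 = m at h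
    subst h
    rw [Finset.sum_range_succ, aux_sum q m hq3, aux_odd q m hq3]
    omega
end

section
/- Let q be a prime power with underlying finite field F of cardinality q, let m ≥ 2, and assume (m, q) ≠ (2, 2) and (m, q) ≠ (2, 3). Write 2m×2m matrices over F in block form with diagonal blocks of sizes 1, 2m−2, 1, and let B denote the (2m−2)×(2m−2) matrix [[0, I_{m−1}], [−I_{m−1}, 0]]. Define the following subgroups of GL_{2m}(F): Q = { the matrix with diagonal blocks 1, I_{2m−2}, 1, lower-left (3,1) entry b ∈ F, and all other off-diagonal blocks zero }, U = { the lower block-triangular matrix with diagonal blocks 1, I_{2m−2}, 1, block (2,1) equal to the column vector −B uᵀ, entry (3,1) equal to b, and block (3,2) equal to the row vector u, where b ∈ F and u ∈ F^{2m−2} }, and S = { the block-diagonal matrix diag(1, A, 1) : A an invertible (2m−2)×(2m−2) matrix over F with A B Aᵀ = B }. Then every subgroup X of U with X ≠ U that is normalized by S (i.e. s⁻¹Xs = X for all s ∈ S) is contained in Q. -/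
namespace Stmt12

/-- The middle index type of size `2(m-1)`. -/
abbrev mid (d : ℕ) := Fin d ⊕ Fin d

/-- The index type of size `2m = 1 + (2m-2) + 1`, with `d = m - 1`. -/
abbrev idx (d : ℕ) := Unit ⊕ (mid d ⊕ Unit)

/-- The matrix `B = [[0, I_{m−1}], [−I_{m−1}, 0]]`. -/
def Bmat (d : ℕ) (F : Type*) [Field F] : Matrix (mid d) (mid d) F :=
  Matrix.fromBlocks 0 1 (-1) 0

/-- The element `U(b, u)` of the group `U`: lower block-triangular with diagonal blocks
`1, I_{2m−2}, 1`, block `(2,1)` equal to `−B uᵀ`, entry `(3,1)` equal to `b` and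
block `(3,2)` equal to the row vector `u`. -/
def elU (d : ℕ) (F : Type*) [Field F] (b : F) (u : mid d → F) :
    Matrix (idx d) (idx d) F :=
  Matrix.of fun i j =>
    match i, j with
    | Sum.inl _, Sum.inl _ => 1
    | Sum.inl _, _ => 0
    | Sum.inr (Sum.inl k), Sum.inl _ => -(Matrix.mulVec (Bmat d F) u k)
    | Sum.inr (Sum.inl k), Sum.inr (Sum.inl k') => if k = k' then 1 else 0
    | Sum.inr (Sum.inl _), Sum.inr (Sum.inr _) => 0
    | Sum.inr (Sum.inr _), Sum.inl _ => b
    | Sum.inr (Sum.inr _), Sum.inr (Sum.inl k') => u k'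
    | Sum.inr (Sum.inr _), Sum.inr (Sum.inr _) => 1

/-- The block-diagonal matrix `diag(1, A, 1)`. -/
def elS (d : ℕ) (F : Type*) [Field F] (A : Matrix (mid d) (mid d) F) :
    Matrix (idx d) (idx d) F :=
  Matrix.of fun i j =>
    match i, j with
    | Sum.inl _, Sum.inl _ => 1
    | Sum.inr (Sum.inl k), Sum.inr (Sum.inl k') => A k k'
    | Sum.inr (Sum.inr _), Sum.inr (Sum.inr _) => 1
    | _, _ => 0

/-- The subgroup `U = { U(b, u) : b ∈ F, u ∈ F^{2m−2} }` (as a set of matrices). -/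
def Uset (d : ℕ) (F : Type*) [Field F] : Set (Matrix (idx d) (idx d) F) :=
  {M | ∃ b u, M = elU d F b u}

/-- The subgroup `Q = { U(b, 0) : b ∈ F }` (as a set of matrices). -/
def Qset (d : ℕ) (F : Type*) [Field F] : Set (Matrix (idx d) (idx d) F) :=
  {M | ∃ b, M = elU d F b 0}

/-- The subgroup `S = { diag(1, A, 1) : A invertible, A B Aᵀ = B }` (as a set of
matrices); it is isomorphic to `Sp_{2m−2}(q)`. -/
def Sset (d : ℕ) (F : Type*) [Field F] : Set (Matrix (idx d) (idx d) F) :=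
  {M | ∃ A : Matrix (mid d) (mid d) F,
    IsUnit A ∧ A * Bmat d F * A.transpose = Bmat d F ∧ M = elS d F A}

end Stmt12

namespace Stmt12
open Matrix

variable {d : ℕ} {F : Type*} [Field F]

theorem aux_B_transpose : (Bmat d F)ᵀ = -Bmat d F := by
  simp [Bmat, Matrix.fromBlocks_transpose, Matrix.fromBlocks_neg]

/-- The symplectic form. -/
def om (u v : mid d → F) : F := u ⬝ᵥ (Bmat d F *ᵥ v)

theorem om_eq (u v : mid d → F) :
    om u v = ∑ i, (u (Sum.inl i) * v (Sum.inr i) - u (Sum.inr i) * v (Sum.inl i)) := by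
  simp [om, Bmat, dotProduct, Fintype.sum_sum_type, Matrix.fromBlocks_mulVec,
    Matrix.neg_mulVec, Finset.sum_sub_distrib, sub_eq_add_neg, Finset.sum_add_distrib]

theorem om_self (u : mid d → F) : om u u = 0 := by
  rw [om_eq]; apply Finset.sum_eq_zero; intros; ring

theorem om_swap (u v : mid d → F) : om u v = - om v u := by
  rw [om_eq, om_eq, ← Finset.sum_neg_distrib]
  apply Finset.sum_congr rfl; intros; ring

theorem om_add_left (u v w : mid d → F) : om (u + v) w = om u w + om v w := by
  simp [om, add_dotProduct]

theorem om_add_right (u v w : mid d → F) : om u (v + w) = om u v + om u w := by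
  simp [om, mulVec_add, dotProduct_add]

theorem om_neg_right (u v : mid d → F) : om u (-v) = - om u v := by
  simp [om, mulVec_neg]

theorem om_smul_right (c : F) (u v : mid d → F) : om u (c • v) = c * om u v := by
  simp [om, mulVec_smul]

theorem om_nondeg (u : mid d → F) (hu : u ≠ 0) : ∃ z, om u z ≠ 0 := by
  by_contra! h
  apply hu
  funext k
  rcases k with i | i
  · have := h (Pi.single (Sum.inr i) 1)
    simpa [om_eq, Pi.single_apply] using this
  · have := h (Pi.single (Sum.inl i) 1)
    simpa [om_eq, Pi.single_apply] using this

theorem sum_idx (f : idx d → F) : ∑ i, f i =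
    f (Sum.inl ()) + ((∑ k, f (Sum.inr (Sum.inl k))) + f (Sum.inr (Sum.inr ()))) := by
  rw [Fintype.sum_sum_type, Fintype.sum_sum_type (f := fun x => f (Sum.inr x))]
  simp [-Fintype.sum_sum_type]

theorem elU_mul (b b' : F) (u u' : mid d → F) :
    elU d F b u * elU d F b' u' = elU d F (b + b' - om u u') (u + u') := by
  ext i j
  rw [Matrix.mul_apply, sum_idx]
  rcases i with i | i | i <;> rcases j with j | j | j <;>
    simp [-Fintype.sum_sum_type, elU, om, dotProduct, mulVec_add] <;> ring

theorem elU_zero : elU d F 0 0 = 1 := by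
  ext i j
  rcases i with i | i | i <;> rcases j with j | j | j <;>
    simp [elU, Matrix.one_apply]

theorem elU_inv (b : F) (u : mid d → F) : (elU d F b u)⁻¹ = elU d F (-b) (-u) := by
  apply Matrix.inv_eq_right_inv
  rw [elU_mul, om_neg_right, om_self]
  simp [elU_zero]

theorem elS_mul (A A' : Matrix (mid d) (mid d) F) :
    elS d F A * elS d F A' = elS d F (A * A') := by
  ext i j
  rw [Matrix.mul_apply, sum_idx]
  rcases i with i | i | i <;> rcases j with j | j | j <;>
    simp [-Fintype.sum_sum_type, elS, Matrix.mul_apply]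

theorem elS_one : elS d F 1 = 1 := by
  ext i j
  rcases i with i | i | i <;> rcases j with j | j | j <;>
    simp [elS, Matrix.one_apply]

theorem elU_elS (b : F) (u : mid d → F) (A : Matrix (mid d) (mid d) F)
    (hA : A * Bmat d F * Aᵀ = Bmat d F) :
    elU d F b u * elS d F A = elS d F A * elU d F b (u ᵥ* A) := by
  have key : A *ᵥ (Bmat d F *ᵥ (u ᵥ* A)) = Bmat d F *ᵥ u := by
    rw [← mulVec_transpose, mulVec_mulVec, mulVec_mulVec, hA]
  ext i j
  rw [Matrix.mul_apply, Matrix.mul_apply, sum_idx, sum_idx]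
  rcases i with i | i | i <;> rcases j with j | j | j <;>
    simp [-Fintype.sum_sum_type, elS, elU]
  · rw [← key]; simp [-Fintype.sum_sum_type, mulVec, dotProduct]
  · rfl

/-- transvection -/
def tv (c : F) (w : mid d → F) : Matrix (mid d) (mid d) F :=
  1 + c • vecMulVec (Bmat d F *ᵥ w) w

theorem vecMul_tv (c : F) (w u : mid d → F) : u ᵥ* tv c w = u + (c * om u w) • w := by
  simp [tv, vecMul_add, vecMul_smul, vecMul_vecMulVec, om, smul_smul]

theorem tv_mul (c : F) (w : mid d → F) : tv c w * tv (-c) w = 1 := by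
  ext i j
  have h : ∀ M N : Matrix (mid d) (mid d) F, (∀ u, u ᵥ* M = u ᵥ* N) → M = N := by
    intro M N h
    ext i j
    have := congrFun (h (Pi.single i 1)) j
    simpa using this
  rw [h (tv c w * tv (-c) w) 1]
  intro u
  rw [← vecMul_vecMul, vecMul_tv, vecMul_tv, om_add_left]
  have : om ((c * om u w) • w) w = 0 := by
    rw [om_swap, om_smul_right, om_self]; simp
  rw [this]
  ext k
  simp

theorem tv_B (c : F) (w : mid d → F) : tv c w * Bmat d F * (tv c w)ᵀ = Bmat d F := by
  have h1 : (w ᵥ* Bmat d F) = - (Bmat d F *ᵥ w) := by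
    rw [← mulVec_transpose, aux_B_transpose, neg_mulVec]
  have h0 : w ⬝ᵥ (Bmat d F *ᵥ w) = 0 := om_self w
  have hT : (tv c w)ᵀ = 1 + c • vecMulVec w (Bmat d F *ᵥ w) := by
    simp [tv, transpose_vecMulVec]
  rw [hT]
  simp only [tv, Matrix.add_mul, Matrix.mul_add, Matrix.one_mul, Matrix.mul_one,
    Matrix.smul_mul, Matrix.mul_smul, vecMulVec_mul, mul_vecMulVec, h1]
  have h3 : vecMulVec (Bmat d F *ᵥ w) (Bmat d F *ᵥ w) *ᵥ w = 0 := by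
    rw [vecMulVec_mulVec, dotProduct_comm, h0]; simp
  simp [vecMulVec_neg, add_mulVec, neg_mulVec, smul_mulVec, h3]

theorem tv_mem (c : F) (w : mid d → F) : elS d F (tv c w) ∈ Sset d F :=
  ⟨_, IsUnit.of_mul_eq_one _ (tv_mul c w), tv_B c w, rfl⟩

theorem tv_conj (c b : F) (w u : mid d → F) :
    (elS d F (tv c w))⁻¹ * elU d F b u * elS d F (tv c w)
      = elU d F b (u + (c * om u w) • w) := by
  have h : (elS d F (tv c w))⁻¹ = elS d F (tv (-c) w) := by
    apply Matrix.inv_eq_right_inv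
    rw [elS_mul, tv_mul, elS_one]
  have h2 : elS d F (tv (-c) w) * elS d F (tv c w) = 1 := by
    rw [elS_mul]
    have := tv_mul (-c) w
    rw [neg_neg] at this
    rw [this, elS_one]
  rw [h, Matrix.mul_assoc, elU_elS _ _ _ (tv_B c w), ← Matrix.mul_assoc, h2, Matrix.one_mul,
    vecMul_tv]

theorem trans_step (X : Set (Matrix (idx d) (idx d) F))
    (hXnorm : ∀ s ∈ Sset d F, ∀ x ∈ X, s⁻¹ * x * s ∈ X) (b : F) (u v : mid d → F)
    (h : om u v ≠ 0) (hu : elU d F b u ∈ X) : elU d F b v ∈ X := by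
  have := hXnorm _ (tv_mem (om u v)⁻¹ (v - u)) _ hu
  rw [tv_conj, sub_eq_add_neg, om_add_right, om_neg_right, om_self, neg_zero, add_zero,
    inv_mul_cancel₀ h, one_smul] at this
  simpa using this

theorem trans_all (X : Set (Matrix (idx d) (idx d) F))
    (hXnorm : ∀ s ∈ Sset d F, ∀ x ∈ X, s⁻¹ * x * s ∈ X) (b : F) (u v : mid d → F)
    (hu0 : u ≠ 0) (hv0 : v ≠ 0) (hu : elU d F b u ∈ X) : elU d F b v ∈ X := by
  have hz : ∃ z, om u z ≠ 0 ∧ om z v ≠ 0 := by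
    obtain ⟨x, hx⟩ := om_nondeg u hu0
    obtain ⟨y, hy⟩ := om_nondeg v hv0
    rw [om_swap, neg_ne_zero] at hy
    by_cases h1 : om x v = 0
    · by_cases h2 : om u y = 0
      · refine ⟨x + y, ?_, ?_⟩
        · rwa [om_add_right, h2, add_zero]
        · rwa [om_add_left, h1, zero_add]
      · exact ⟨y, h2, hy⟩
    · exact ⟨x, hx, h1⟩
  obtain ⟨z, h1, h2⟩ := hz
  exact trans_step X hXnorm b z v h2 (trans_step X hXnorm b u z h1 hu)

theorem exists_isotropic [Fintype F] (hd : 1 ≤ d) (h : ¬ (d = 1 ∧ Fintype.card F = 2)) :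
    ∃ u v : mid d → F, u ≠ 0 ∧ v ≠ 0 ∧ u + v ≠ 0 ∧ om u v = 0 := by
  classical
  by_cases h2 : 2 ≤ d
  · let i : Fin d := ⟨0, by omega⟩
    let j : Fin d := ⟨1, by omega⟩
    have hij : i ≠ j := by simp [i, j]
    refine ⟨Pi.single (Sum.inl i) 1, Pi.single (Sum.inl j) 1, ?_, ?_, ?_, ?_⟩
    · simp
    · simp
    · intro h
      have := congrFun h (Sum.inl i)
      simp [Pi.single_apply, hij] at this
    · simp [om_eq, Pi.single_apply]
  · have hd1 : d = 1 := by omega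
    have hc : 2 < Fintype.card F := by
      have := Fintype.one_lt_card (α := F)
      have : Fintype.card F ≠ 2 := fun hh => h ⟨hd1, hh⟩
      omega
    obtain ⟨a, ha⟩ : ∃ a : F, a ∉ ({0, -1} : Finset F) := by
      by_contra! hh
      have h1 : (Finset.univ : Finset F) ⊆ {0, -1} := fun x _ => hh x
      have h2 := Finset.card_le_card h1
      have h3 := Finset.card_le_two (a := (0 : F)) (b := -1)
      rw [Finset.card_univ] at h2
      omega
    simp only [Finset.mem_insert, Finset.mem_singleton, not_or] at ha
    let i : Fin d := ⟨0, by omega⟩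
    refine ⟨Pi.single (Sum.inl i) 1, Pi.single (Sum.inl i) a, ?_, ?_, ?_, ?_⟩
    · simp
    · simpa using ha.1
    · rw [← Pi.single_add]
      intro h
      rw [Pi.single_eq_zero_iff] at h
      exact ha.2 (by linear_combination h)
    · simp [om_eq, Pi.single_apply]

end Stmt12

open Stmt12 in
/-- Let `q` be a prime power, `m ≥ 2` with `(m,q) ≠ (2,2), (2,3)`.
Every subgroup `X` of `U` with `X ≠ U` that is normalized by `S` is contained in `Q`. -/
theorem stmt_12 (m q : ℕ) (hm : 2 ≤ m) (F : Type*) [Field F] [Fintype F]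
    (hq : Fintype.card F = q)
    (h22 : ¬(m = 2 ∧ q = 2)) (h23 : ¬(m = 2 ∧ q = 3))
    (X : Set (Matrix (idx (m - 1)) (idx (m - 1)) F))
    (hXU : X ⊆ Uset (m - 1) F)
    (hXone : (1 : Matrix (idx (m - 1)) (idx (m - 1)) F) ∈ X)
    (hXmul : ∀ x ∈ X, ∀ y ∈ X, x * y ∈ X)
    (hXinv : ∀ x ∈ X, x⁻¹ ∈ X)
    (hXne : X ≠ Uset (m - 1) F)
    (hXnorm : ∀ s ∈ Sset (m - 1) F, ∀ x ∈ X, s⁻¹ * x * s ∈ X) :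
    X ⊆ Qset (m - 1) F := by
  classical
  by_contra hnot
  obtain ⟨x, hx, hxQ⟩ := Set.not_subset.1 hnot
  obtain ⟨b, u, rfl⟩ := hXU hx
  have hu0 : u ≠ 0 := by
    rintro rfl
    exact hxQ ⟨b, rfl⟩
  have hall : ∀ v, v ≠ 0 → elU (m - 1) F b v ∈ X := fun v hv =>
    trans_all X hXnorm b u v hu0 hv hx
  have hprod : ∀ v w : mid (m - 1) → F, v ≠ 0 → w ≠ 0 → v + w ≠ 0 → elU (m - 1) F (b - om v w) 0 ∈ X := by
    intro v w hv hw hvw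
    have h1 := hXmul _ (hXmul _ (hall v hv) _ (hall w hw)) _ (hXinv _ (hall _ hvw))
    rw [elU_inv, elU_mul, elU_mul, om_neg_right, om_self] at h1
    convert h1 using 1
    congr 1
    · ring
    · simp
  obtain ⟨v, w, hv, hw, hvw, h0⟩ := exists_isotropic (F := F) (d := m - 1) (by omega)
    (fun h => h22 ⟨by omega, by omega⟩)
  have hb : elU (m - 1) F b 0 ∈ X := by
    have := hprod v w hv hw hvw
    rwa [h0, sub_zero] at this
  have hQ : ∀ t, elU (m - 1) F t 0 ∈ X := by
    intro t
    by_cases ht : t = 0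
    · rw [ht, elU_zero]; exact hXone
    · let i : Fin (m - 1) := ⟨0, by omega⟩
      have hom : om (Pi.single (Sum.inl i) 1 : mid (m - 1) → F) (Pi.single (Sum.inr i) t) = t := by
        simp [om_eq, Pi.single_apply]
      have h1 := hprod (Pi.single (Sum.inl i) 1) (Pi.single (Sum.inr i) t) (by simp)
        (by simpa using ht) (by
          intro h
          have := congrFun h (Sum.inl i)
          simp [Pi.single_apply] at this)
      rw [hom] at h1
      have h2 := hXmul _ hb _ (hXinv _ h1)
      rw [elU_inv, elU_mul, om_neg_right, om_self] at h2
      convert h2 using 1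
      congr 1
      · ring
      · simp
  apply hXne
  apply Set.Subset.antisymm hXU
  rintro _ ⟨c, v, rfl⟩
  by_cases hv : v = 0
  · rw [hv]; exact hQ c
  · have h2 := hXmul _ (hQ (c - b)) _ (hall v hv)
    rw [elU_mul] at h2
    convert h2 using 1
    congr 1
    · simp [om]
    · simp
end

section
/- Let Γ be a connected finite simple graph and let Z be a group of automorphisms of Γ that is arc-transitive, i.e. transitive on the set of ordered pairs of adjacent vertices. Let (α, β) be an arc of Γ, let Z_α be the stabilizer of α in Z, let Z_{αβ} = Z_α ∩ Z_β, and let Z_α^{[1]} = { z ∈ Z_α : z fixes every neighbour of α }. For a vertex γ and a subgroup Y of the stabilizer Z_γ, let Y^{Γ(γ)} denote the image of Y under the restriction homomorphism to the group of permutations of the neighbourhood Γ(γ). Then either Z_α^{[1]} = 1, so that the restriction homomorphism gives an isomorphism Z_α ≅ Z_α^{Γ(α)}, or (Z_α^{[1]})^{Γ(β)} is a nontrivial normal subgroup of Z_{αβ}^{Γ(β)}. -/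
namespace Stmt14

variable {V : Type*}

/-- The restriction homomorphism from the stabilizer of a vertex `γ` (inside an
adjacency-preserving group `Z ≤ Sym(V)`) to the group of permutations of the
neighbourhood `Γ(γ)`. -/
def restrictPerm (Γ : SimpleGraph V) (Z : Subgroup (Equiv.Perm V))
    (hAut : ∀ z ∈ Z, ∀ u v : V, Γ.Adj (z u) (z v) ↔ Γ.Adj u v) (γ : V) :
    ↥(Z ⊓ MulAction.stabilizer (Equiv.Perm V) γ) →* Equiv.Perm (Γ.neighborSet γ) where
  toFun z :=
    Equiv.subtypeEquiv (z : Equiv.Perm V) (fun a => by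
      have hz : (z : Equiv.Perm V) γ = γ := z.2.2
      constructor
      · intro ha
        have h2 : Γ.Adj ((z : Equiv.Perm V) γ) ((z : Equiv.Perm V) a) :=
          (hAut (z : Equiv.Perm V) z.2.1 γ a).mpr ha
        rw [hz] at h2
        exact h2
      · intro ha
        have h2 : Γ.Adj ((z : Equiv.Perm V) γ) ((z : Equiv.Perm V) a) := by
          rw [hz]; exact ha
        exact (hAut (z : Equiv.Perm V) z.2.1 γ a).mp h2)
  map_one' := by
    ext a
    rfl
  map_mul' x y := by
    ext a
    rfl

/-- The pointwise stabilizer `Z_α^{[1]}` of the closed neighbourhood of `α`: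
elements of the stabilizer `Z_α` fixing every neighbour of `α`. -/
def fix1 (Γ : SimpleGraph V) (Z : Subgroup (Equiv.Perm V)) (α : V) :
    Subgroup (Equiv.Perm V) :=
  Z ⊓ MulAction.stabilizer (Equiv.Perm V) α ⊓
    ⨅ γ ∈ Γ.neighborSet α, MulAction.stabilizer (Equiv.Perm V) γ

end Stmt14

namespace Stmt14

theorem mem_fix1 {V : Type*} {Γ : SimpleGraph V} {Z : Subgroup (Equiv.Perm V)} {α : V}
    {z : Equiv.Perm V} :
    z ∈ fix1 Γ Z α ↔ z ∈ Z ∧ z α = α ∧ ∀ γ, Γ.Adj α γ → z γ = γ := by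
  simp [fix1, Subgroup.mem_inf, Subgroup.mem_iInf, MulAction.mem_stabilizer_iff, and_assoc]

theorem conj_mem_fix1 {V : Type*} {Γ : SimpleGraph V} {Z : Subgroup (Equiv.Perm V)}
    (hAut : ∀ z ∈ Z, ∀ u v : V, Γ.Adj (z u) (z v) ↔ Γ.Adj u v) {u v : V}
    {w z : Equiv.Perm V} (hw : w ∈ Z) (hwu : w u = v) (hz : z ∈ fix1 Γ Z u) :
    w * z * w⁻¹ ∈ fix1 Γ Z v := by
  rw [mem_fix1] at hz ⊢
  obtain ⟨h1, h2, h3⟩ := hz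
  refine ⟨Z.mul_mem (Z.mul_mem hw h1) (Z.inv_mem hw), ?_, ?_⟩
  · subst hwu
    simp [h2]
  · intro γ hγ
    have h4 : Γ.Adj u (w⁻¹ γ) := by
      rw [← hAut w hw]
      simpa [hwu] using hγ
    have h5 := h3 _ h4
    simp only [Equiv.Perm.mul_apply, h5]
    simp

theorem fix1_le_of_adj {V : Type*} {Γ : SimpleGraph V} {Z : Subgroup (Equiv.Perm V)}
    (hAut : ∀ z ∈ Z, ∀ u v : V, Γ.Adj (z u) (z v) ↔ Γ.Adj u v)
    (harc : ∀ u v u' v' : V, Γ.Adj u v → Γ.Adj u' v' → ∃ z ∈ Z, z u = u' ∧ z v = v')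
    {α β : V} (hαβ : Γ.Adj α β) (hle : fix1 Γ Z α ≤ fix1 Γ Z β) {u v : V}
    (huv : Γ.Adj u v) : fix1 Γ Z u ≤ fix1 Γ Z v := by
  intro z hz
  obtain ⟨w, hw, h1, h2⟩ := harc α β u v hαβ huv
  have h3 : w⁻¹ * z * w⁻¹⁻¹ ∈ fix1 Γ Z α :=
    conj_mem_fix1 hAut (Z.inv_mem hw) (by rw [← h1]; simp) hz
  have h4 := conj_mem_fix1 hAut hw h2 (hle h3)
  have h5 : w * (w⁻¹ * z * w⁻¹⁻¹) * w⁻¹ = z := by group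
  rwa [h5] at h4

theorem fix1_eq_bot {V : Type*} {Γ : SimpleGraph V} (hconn : Γ.Connected)
    {Z : Subgroup (Equiv.Perm V)}
    (hAut : ∀ z ∈ Z, ∀ u v : V, Γ.Adj (z u) (z v) ↔ Γ.Adj u v)
    (harc : ∀ u v u' v' : V, Γ.Adj u v → Γ.Adj u' v' → ∃ z ∈ Z, z u = u' ∧ z v = v')
    {α β : V} (hαβ : Γ.Adj α β) (hle : fix1 Γ Z α ≤ fix1 Γ Z β) : fix1 Γ Z α = ⊥ := by
  have key : ∀ {u v : V}, Γ.Walk u v → fix1 Γ Z u ≤ fix1 Γ Z v := by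
    intro u v p
    induction p with
    | nil => exact le_rfl
    | cons h _ ih => exact (fix1_le_of_adj hAut harc hαβ hle h).trans ih
  rw [eq_bot_iff]
  intro z hz
  rw [Subgroup.mem_bot]
  ext v
  obtain ⟨p⟩ := hconn.preconnected α v
  exact (mem_fix1.1 (key p hz)).2.1

theorem injective_of_fix1 {V : Type*} {Γ : SimpleGraph V} {Z : Subgroup (Equiv.Perm V)}
    (hAut : ∀ z ∈ Z, ∀ u v : V, Γ.Adj (z u) (z v) ↔ Γ.Adj u v)
    {α : V} (h : fix1 Γ Z α = ⊥) : Function.Injective (restrictPerm Γ Z hAut α) := by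
  rw [injective_iff_map_eq_one]
  intro z hz
  have hm : (z : Equiv.Perm V) ∈ fix1 Γ Z α := by
    refine mem_fix1.2 ⟨z.2.1, z.2.2, fun γ hγ => ?_⟩
    exact congrArg Subtype.val (DFunLike.congr_fun hz (⟨γ, hγ⟩ : Γ.neighborSet α))
  rw [h, Subgroup.mem_bot] at hm
  exact Subtype.ext hm

end Stmt14

open Stmt14 in
/-- Let `Γ` be a connected finite graph, `Z` an arc-transitive group
of automorphisms of `Γ`, and `(α, β)` an arc. Then either `Z_α^{[1]} = 1` and the
restriction map `Z_α → Z_α^{Γ(α)}` is injective (hence an isomorphism onto its image),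
or the image of `Z_α^{[1]}` in the permutation group of `Γ(β)` is a nontrivial normal
subgroup of the image `Z_{αβ}^{Γ(β)}` of `Z_{αβ}`. -/
theorem stmt_14 {V : Type*} [Finite V] (Γ : SimpleGraph V) (hconn : Γ.Connected)
    (Z : Subgroup (Equiv.Perm V))
    (hAut : ∀ z ∈ Z, ∀ u v : V, Γ.Adj (z u) (z v) ↔ Γ.Adj u v)
    (harc : ∀ u v u' v' : V, Γ.Adj u v → Γ.Adj u' v' → ∃ z ∈ Z, z u = u' ∧ z v = v')
    (α β : V) (hαβ : Γ.Adj α β) :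
    (fix1 Γ Z α = ⊥ ∧ Function.Injective (restrictPerm Γ Z hAut α)) ∨
    (((fix1 Γ Z α).subgroupOf (Z ⊓ MulAction.stabilizer (Equiv.Perm V) β)).map
        (restrictPerm Γ Z hAut β) ≠ ⊥ ∧
      ((fix1 Γ Z α).subgroupOf (Z ⊓ MulAction.stabilizer (Equiv.Perm V) β)).map
          (restrictPerm Γ Z hAut β) ≤
        (((Z ⊓ MulAction.stabilizer (Equiv.Perm V) α ⊓
            MulAction.stabilizer (Equiv.Perm V) β).subgroupOf
              (Z ⊓ MulAction.stabilizer (Equiv.Perm V) β)).map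
          (restrictPerm Γ Z hAut β)) ∧
      ∀ g ∈ ((Z ⊓ MulAction.stabilizer (Equiv.Perm V) α ⊓
            MulAction.stabilizer (Equiv.Perm V) β).subgroupOf
              (Z ⊓ MulAction.stabilizer (Equiv.Perm V) β)).map
          (restrictPerm Γ Z hAut β),
        ∀ x ∈ ((fix1 Γ Z α).subgroupOf (Z ⊓ MulAction.stabilizer (Equiv.Perm V) β)).map
            (restrictPerm Γ Z hAut β),
          g * x * g⁻¹ ∈
            ((fix1 Γ Z α).subgroupOf (Z ⊓ MulAction.stabilizer (Equiv.Perm V) β)).map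
              (restrictPerm Γ Z hAut β)) := by
  by_cases hbot : fix1 Γ Z α = ⊥
  · exact Or.inl ⟨hbot, injective_of_fix1 hAut hbot⟩
  right
  refine ⟨?_, ?_, ?_⟩
  · intro hmap
    apply hbot
    refine fix1_eq_bot hconn hAut harc hαβ ?_
    intro z hz
    have hz' := mem_fix1.1 hz
    have hzβ : z β = β := hz'.2.2 β hαβ
    refine mem_fix1.2 ⟨hz'.1, hzβ, fun γ hγ => ?_⟩
    let y : ↥(Z ⊓ MulAction.stabilizer (Equiv.Perm V) β) := ⟨z, hz'.1, hzβ⟩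
    have h1 : restrictPerm Γ Z hAut β y ∈
        ((fix1 Γ Z α).subgroupOf (Z ⊓ MulAction.stabilizer (Equiv.Perm V) β)).map
          (restrictPerm Γ Z hAut β) := Subgroup.mem_map_of_mem _ hz
    rw [hmap, Subgroup.mem_bot] at h1
    exact congrArg Subtype.val (DFunLike.congr_fun h1 (⟨γ, hγ⟩ : Γ.neighborSet β))
  · apply Subgroup.map_mono
    intro z hz
    have hz' := mem_fix1.1 (Subgroup.mem_subgroupOf.1 hz)
    exact ⟨⟨hz'.1, hz'.2.1⟩, hz'.2.2 β hαβ⟩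
  · rintro _ ⟨g, hg, rfl⟩ _ ⟨x, hx, rfl⟩
    refine ⟨g * x * g⁻¹, ?_, by simp⟩
    exact conj_mem_fix1 hAut hg.1.1 hg.1.2 hx
end
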